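/- If Riemann's Hypothesis holds, then for every ε > 0 there exists X such that for all x > X, |θ(x) − x| ≤ x^{1/2+ε}. -/

import Mathlib

open Filter Real

/-- The first Chebyshev function θ(y) = ∑_{p ≤ y} log p. -/
noncomputable def chebTheta (y : ℝ) : ℝ :=
  ∑ p ∈ (Finset.range (⌊y⌋₊ + 1)).filter Nat.Prime, Real.log p

section

open MeasureTheory Set Topology

/-- A step function `t ↦ ∑_{1 ≤ k ≤ t} f k` is measurable. -/
lemma measurable_sum_Icc_floor (f : ℕ → ℝ) :
    Measurable fun t : ℝ ↦ ∑ k ∈ Finset.Icc 1 ⌊t⌋₊, f k :=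
  (measurable_from_top (f := fun n : ℕ ↦ ∑ k ∈ Finset.Icc 1 n, f k)).comp Nat.measurable_floor

/-- Integrability on `(1, ∞)` of a measurable function of polynomial growth against a power. -/
lemma integrableOn_Ioi_one_mul_cpow {g : ℝ → ℝ} (hg : Measurable g) {C r : ℝ}
    (hC : ∀ t, 1 < t → |g t| ≤ C * t ^ r) {s : ℂ} (hs : r < s.re) :
    IntegrableOn (fun t : ℝ ↦ (g t : ℂ) * (t : ℂ) ^ (-(s + 1))) (Ioi 1) := by
  have hint : IntegrableOn (fun t : ℝ ↦ C * t ^ (r - s.re - 1)) (Ioi 1) :=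
    (integrableOn_Ioi_rpow_of_lt (by linarith) one_pos).const_mul C
  refine Integrable.mono' hint ?_ ?_
  · refine AEStronglyMeasurable.mul (Complex.measurable_ofReal.comp hg).aestronglyMeasurable ?_
    refine ContinuousOn.aestronglyMeasurable (fun t ht ↦ ?_) measurableSet_Ioi
    exact (Complex.continuousAt_ofReal_cpow_const _ _
      (Or.inr (zero_lt_one.trans ht).ne')).continuousWithinAt
  · refine (ae_restrict_iff' measurableSet_Ioi).2 (Eventually.of_forall fun t ht ↦ ?_)
    have ht0 : (0 : ℝ) < t := zero_lt_one.trans ht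
    rw [norm_mul, Complex.norm_cpow_eq_rpow_re_of_pos ht0, Complex.norm_real, Real.norm_eq_abs]
    calc |g t| * t ^ (-(s + 1)).re ≤ C * t ^ r * t ^ (-(s + 1)).re := by
          gcongr; exact hC t ht
      _ = C * t ^ (r - s.re - 1) := by
          rw [mul_assoc, ← Real.rpow_add ht0]; congr 2; simp; ring

/-- The Dirichlet series of a nonnegative `f` with partial sums of linear growth, with the
Dirichlet integral of `t` subtracted. -/
lemma LSeries_sub_div_eq_mul_integral {f : ℕ → ℝ} (hf : ∀ n, 0 ≤ f n) {C : ℝ}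
    (hC : ∀ n : ℕ, ∑ k ∈ Finset.Icc 1 n, f k ≤ C * n) {s : ℂ} (hs : 1 < s.re) :
    LSeries (fun n ↦ f n) s - s / (s - 1) =
      s * ∫ t in Ioi (1 : ℝ), ((∑ k ∈ Finset.Icc 1 ⌊t⌋₊, f k - t : ℝ) : ℂ) *
        (t : ℂ) ^ (-(s + 1)) := by
  have hS0 (n : ℕ) : 0 ≤ ∑ k ∈ Finset.Icc 1 n, f k := Finset.sum_nonneg fun _ _ ↦ hf _
  have hC0 : 0 ≤ C := by simpa using (hS0 1).trans (hC 1)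
  have hO : (fun n : ℕ ↦ ∑ k ∈ Finset.Icc 1 n, f k) =O[atTop] fun n ↦ (n : ℝ) ^ (1 : ℝ) :=
    Asymptotics.IsBigO.of_bound C <| Eventually.of_forall fun n ↦ by
      rw [Real.norm_of_nonneg (hS0 n), Real.rpow_one, Real.norm_of_nonneg n.cast_nonneg]
      exact hC n
  have hs1 : s - 1 ≠ 0 := by
    intro h; rw [sub_eq_zero] at h; simp [h] at hs
  have hid : ∫ t in Ioi (1 : ℝ), (t : ℂ) * (t : ℂ) ^ (-(s + 1)) = 1 / (s - 1) := by
    have : ∫ t in Ioi (1 : ℝ), (t : ℂ) * (t : ℂ) ^ (-(s + 1)) =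
        ∫ t in Ioi (1 : ℝ), (t : ℂ) ^ (-s) := by
      refine setIntegral_congr_fun measurableSet_Ioi fun t ht ↦ ?_
      have ht0 : (t : ℂ) ≠ 0 := by exact_mod_cast (zero_lt_one.trans ht).ne'
      calc (t : ℂ) * (t : ℂ) ^ (-(s + 1)) = (t : ℂ) ^ (1 : ℂ) * (t : ℂ) ^ (-(s + 1)) := by
            rw [Complex.cpow_one]
        _ = (t : ℂ) ^ (-s) := by rw [← Complex.cpow_add _ _ ht0]; congr 1; ring
    rw [this, integral_Ioi_cpow_of_lt (by simpa using hs) one_pos]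
    have h2 : -s + 1 ≠ 0 := by
      intro h; apply hs1; linear_combination -h
    simp only [Complex.ofReal_one, Complex.one_cpow]
    field_simp
    ring
  rw [LSeries_eq_mul_integral_of_nonneg f zero_le_one hs hO hf]
  have h1 := integrableOn_Ioi_one_mul_cpow (measurable_sum_Icc_floor f) (C := C) (r := 1)
    (fun t ht ↦ by
      rw [abs_of_nonneg (hS0 _), Real.rpow_one]
      exact (hC _).trans (by gcongr; exact Nat.floor_le (by linarith))) hs
  have h2 := integrableOn_Ioi_one_mul_cpow (g := fun t ↦ t) measurable_id (C := 1) (r := 1)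
    (fun t ht ↦ by rw [abs_of_pos (by linarith), Real.rpow_one, one_mul]) hs
  have : s / (s - 1) = s * ∫ t in Ioi (1 : ℝ), (t : ℂ) * (t : ℂ) ^ (-(s + 1)) := by
    rw [hid]; ring
  have h1' : IntegrableOn (fun t : ℝ ↦ (∑ k ∈ Finset.Icc 1 ⌊t⌋₊, (f k : ℂ)) *
      (t : ℂ) ^ (-(s + 1))) (Ioi 1) := by
    simpa only [Complex.ofReal_sum] using h1
  rw [this, ← mul_sub, ← integral_sub h1' h2]
  congr 2
  ext t
  push_cast
  ring

/-- The entire function `(s - 1) ζ(s)`, with the value `1` at `s = 1`. -/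
noncomputable def subOneMulZeta : ℂ → ℂ :=
  Function.update (fun s ↦ (s - 1) * riemannZeta s) 1 1

lemma subOneMulZeta_of_ne {s : ℂ} (hs : s ≠ 1) : subOneMulZeta s = (s - 1) * riemannZeta s :=
  Function.update_of_ne hs _ _

lemma subOneMulZeta_one : subOneMulZeta 1 = 1 := Function.update_self _ _ _

lemma subOneMulZeta_eventuallyEq {s : ℂ} (hs : s ≠ 1) :
    subOneMulZeta =ᶠ[𝓝 s] fun z ↦ (z - 1) * riemannZeta z := by
  filter_upwards [isOpen_ne.mem_nhds hs] with z hz using subOneMulZeta_of_ne hz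

lemma differentiable_subOneMulZeta : Differentiable ℂ subOneMulZeta := by
  have hne (s : ℂ) (hs : s ≠ 1) : DifferentiableAt ℂ subOneMulZeta s :=
    ((differentiableAt_id.sub_const 1).mul (differentiableAt_riemannZeta hs)).congr_of_eventuallyEq
      (subOneMulZeta_eventuallyEq hs)
  intro s
  rcases eq_or_ne s 1 with rfl | hs
  · refine (Complex.analyticAt_of_differentiable_on_punctured_nhds_of_continuousAt ?_
      ?_).differentiableAt
    · exact eventually_mem_nhdsWithin.mono fun z hz ↦ hne z hz
    · exact continuousAt_update_same.2 riemannZeta_residue_one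
  · exact hne s hs

/-- The function `t - ⌊t⌋` on `(1, ∞)`, extended by zero. -/
noncomputable def fractAboveOne : ℝ → ℂ := indicator (Ioi 1) fun t ↦ ((Int.fract t : ℝ) : ℂ)

lemma norm_fractAboveOne_le (t : ℝ) : ‖fractAboveOne t‖ ≤ 1 := by
  rw [fractAboveOne]
  refine (norm_indicator_le_norm_self _ _).trans ?_
  rw [Complex.norm_real, Real.norm_of_nonneg (Int.fract_nonneg t)]
  exact (Int.fract_lt_one t).le

lemma mellin_fractAboveOne (s : ℂ) :
    mellin fractAboveOne (-s) =
      ∫ t in Ioi (1 : ℝ), ((Int.fract t : ℝ) : ℂ) * (t : ℂ) ^ (-(s + 1)) := by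
  rw [mellin, ← integral_indicator measurableSet_Ioi, ← integral_indicator measurableSet_Ioi]
  congr 1
  ext t
  by_cases ht : 1 < t
  · simp [fractAboveOne, ht, zero_lt_one.trans ht, mul_comm, sub_eq_add_neg, add_comm]
  · simp [fractAboveOne, ht]

lemma measurable_fractAboveOne : Measurable fractAboveOne :=
  (Complex.measurable_ofReal.comp measurable_fract).indicator measurableSet_Ioi

lemma differentiableAt_mellin_fractAboveOne {s : ℂ} (hs : 0 < s.re) :
    DifferentiableAt ℂ (fun z ↦ mellin fractAboveOne (-z)) s := by
  refine DifferentiableAt.comp (g := mellin fractAboveOne) (f := fun z ↦ -z) s ?_ (by fun_prop)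
  refine mellin_differentiableAt_of_isBigO_rpow (a := 0) (b := -s.re - 1) ?_ ?_ ?_ ?_ ?_
  · refine LocallyIntegrable.locallyIntegrableOn ?_ _
    refine (locallyIntegrable_const (1 : ℝ)).mono measurable_fractAboveOne.aestronglyMeasurable ?_
    exact Eventually.of_forall fun t ↦ by simpa using norm_fractAboveOne_le t
  · exact Asymptotics.IsBigO.of_bound 1 <| Eventually.of_forall fun t ↦ by
      simpa using norm_fractAboveOne_le t
  · simpa using hs
  · refine Asymptotics.IsBigO.of_bound 1 ?_
    filter_upwards [Ioo_mem_nhdsGT (zero_lt_one' ℝ)] with t ht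
    simp [fractAboveOne, not_lt.2 ht.2.le]
  · simp

lemma subOneMulZeta_eq {s : ℂ} (hs : 0 < s.re) :
    subOneMulZeta s = s - s * (s - 1) * mellin fractAboveOne (-s) := by
  set U : Set ℂ := {z | 0 < z.re}
  have hU : IsOpen U := isOpen_lt continuous_const Complex.continuous_re
  have hUc : IsPreconnected U := (convex_halfSpace_re_gt 0).isPreconnected
  have hF : AnalyticOnNhd ℂ (fun z ↦ z - z * (z - 1) * mellin fractAboveOne (-z)) U := by
    refine DifferentiableOn.analyticOnNhd (fun z hz ↦ ?_) hU
    have := differentiableAt_mellin_fractAboveOne hz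
    exact DifferentiableAt.differentiableWithinAt (by fun_prop)
  have hH : AnalyticOnNhd ℂ subOneMulZeta U :=
    differentiable_subOneMulZeta.differentiableOn.analyticOnNhd hU
  refine hH.eqOn_of_preconnected_of_eventuallyEq hF hUc (z₀ := 2) (by simp [U]) ?_ hs
  have h2 : {z : ℂ | 1 < z.re} ∈ 𝓝 (2 : ℂ) :=
    (isOpen_lt continuous_const Complex.continuous_re).mem_nhds (by simp)
  filter_upwards [h2] with z hz
  have hz1 : z ≠ 1 := by rintro rfl; simp at hz
  have hz1' : z - 1 ≠ 0 := sub_ne_zero.2 hz1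
  have key := LSeries_sub_div_eq_mul_integral (f := fun _ ↦ 1) (fun _ ↦ zero_le_one) (C := 1)
    (fun n ↦ by simp) hz
  have hL : LSeries (fun _ : ℕ ↦ ((1 : ℝ) : ℂ)) z = riemannZeta z := by
    rw [← LSeries_one_eq_riemannZeta hz]; congr 1
  rw [hL] at key
  have hI : ∫ t in Ioi (1 : ℝ), ((∑ k ∈ Finset.Icc 1 ⌊t⌋₊, (1 : ℝ) - t : ℝ) : ℂ) *
      (t : ℂ) ^ (-(z + 1)) = - mellin fractAboveOne (-z) := by
    rw [mellin_fractAboveOne, ← integral_neg]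
    refine setIntegral_congr_fun measurableSet_Ioi fun t ht ↦ ?_
    have : (∑ k ∈ Finset.Icc 1 ⌊t⌋₊, (1 : ℝ) - t : ℝ) = - Int.fract t := by
      have := natCast_floor_eq_intCast_floor (R := ℝ)
        (zero_le_one.trans (le_of_lt ht) : (0 : ℝ) ≤ t)
      rw [Int.fract, ← this]; simp
    simp only [this]
    push_cast
    ring
  rw [hI] at key
  rw [subOneMulZeta_of_ne hz1]
  field_simp at key
  linear_combination key

lemma norm_subOneMulZeta_le {s : ℂ} (hs : 1 / 2 ≤ s.re) :
    ‖subOneMulZeta s‖ ≤ ‖s‖ + 2 * (‖s‖ * ‖s - 1‖) := by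
  have hs0 : 0 < s.re := by linarith
  have hM : ‖mellin fractAboveOne (-s)‖ ≤ 2 := by
    rw [mellin_fractAboveOne]
    calc _ ≤ ∫ t in Ioi (1 : ℝ), t ^ (-s.re - 1) := by
          refine norm_integral_le_of_norm_le
            (integrableOn_Ioi_rpow_of_lt (by linarith) one_pos) ?_
          refine (ae_restrict_iff' measurableSet_Ioi).2 (Eventually.of_forall fun t ht ↦ ?_)
          have ht0 : (0 : ℝ) < t := zero_lt_one.trans ht
          rw [norm_mul, Complex.norm_cpow_eq_rpow_re_of_pos ht0, Complex.norm_real,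
            Real.norm_of_nonneg (Int.fract_nonneg t)]
          have : (-(s + 1)).re = -s.re - 1 := by simp; ring
          rw [this]
          exact mul_le_of_le_one_left (by positivity) (Int.fract_lt_one t).le
      _ = 1 / s.re := by
          rw [integral_Ioi_rpow_of_lt (by linarith) one_pos]
          simp only [Real.one_rpow, sub_add_cancel]
          field_simp
      _ ≤ 2 := by rw [div_le_iff₀ hs0]; linarith
  rw [subOneMulZeta_eq hs0]
  calc _ ≤ ‖s‖ + ‖s * (s - 1) * mellin fractAboveOne (-s)‖ := norm_sub_le _ _
    _ ≤ _ := by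
      rw [norm_mul, norm_mul, mul_comm 2]
      gcongr

lemma subOneMulZeta_ne_zero (hRH : RiemannHypothesis) {s : ℂ} (hs : 1 / 2 < s.re) :
    subOneMulZeta s ≠ 0 := by
  rcases eq_or_ne s 1 with rfl | h1
  · simp [subOneMulZeta_one]
  · rw [subOneMulZeta_of_ne h1]
    refine mul_ne_zero (sub_ne_zero.2 h1) fun h0 ↦ ?_
    refine hs.ne' (hRH s h0 ?_ h1)
    rintro ⟨n, rfl⟩
    have : ((-2 * ((n : ℂ) + 1)).re) = -2 * ((n : ℝ) + 1) := by simp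
    rw [this] at hs
    have : (0 : ℝ) ≤ n := n.cast_nonneg
    linarith

lemma one_fifth_le_norm_subOneMulZeta (t : ℝ) :
    1 / 5 ≤ ‖subOneMulZeta (2 + t * Complex.I)‖ := by
  set s : ℂ := 2 + t * Complex.I with hs
  have hre : s.re = 2 := by simp [hs]
  have h1 : s ≠ 1 := by intro h; rw [h] at hre; norm_num at hre
  have hz : ‖riemannZeta s - 1‖ ≤ 4 / 5 := by
    have hre1 : 1 < s.re := by rw [hre]; norm_num
    have hsum : HasSum (fun n : ℕ ↦ (1 : ℝ) / ((n : ℝ) + 1 + 1) ^ 2) (π ^ 2 / 6 - 1) := by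
      have := (hasSum_nat_add_iff' 2).2 hasSum_zeta_two
      simp only [Finset.sum_range_succ, Finset.sum_range_zero] at this
      norm_num [add_assoc] at this ⊢
      exact this
    have hsumm : Summable fun n : ℕ ↦ 1 / ((n : ℂ) + 1) ^ s := by
      have := (Complex.summable_one_div_nat_cpow.2 hre1)
      simpa using (summable_nat_add_iff 1).2 this
    have : riemannZeta s - 1 = ∑' n : ℕ, 1 / ((n : ℂ) + 1 + 1) ^ s := by
      rw [zeta_eq_tsum_one_div_nat_add_one_cpow hre1, hsumm.tsum_eq_zero_add]
      simp
    rw [this]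
    refine (tsum_of_norm_bounded hsum fun n ↦ ?_).trans ?_
    · have hn : ((n : ℂ) + 1 + 1) = ((n + 1 + 1 : ℝ) : ℂ) := by push_cast; ring
      rw [norm_div, hn, Complex.norm_cpow_eq_rpow_re_of_pos (by positivity), hre]
      simp
    · nlinarith [Real.pi_lt_d2, Real.pi_pos]
  have hz' : 1 / 5 ≤ ‖riemannZeta s‖ := by
    have := norm_sub_norm_le (1 : ℂ) (1 - riemannZeta s)
    rw [norm_sub_rev 1] at this
    simp at this
    linarith
  have hs1 : 1 ≤ ‖s - 1‖ := by
    have := Complex.abs_re_le_norm (s - 1)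
    rw [Complex.sub_re, hre] at this
    norm_num at this
    exact this
  rw [subOneMulZeta_of_ne h1, norm_mul]
  nlinarith [norm_nonneg (riemannZeta s)]

/-- Bound for the logarithmic derivative of a nonvanishing function on a disc, in terms of the
maximum of the function relative to its value at the centre. -/
lemma norm_logDeriv_le_of_ne_zero {f : ℂ → ℂ} {c : ℂ} {r R B : ℝ} (hr : 0 ≤ r) (hrR : r < R)
    (hf : DifferentiableOn ℂ f (Metric.ball c R)) (hf0 : ∀ z ∈ Metric.ball c R, f z ≠ 0)
    (hB : 1 < B) (hfB : ∀ z ∈ Metric.ball c R, ‖f z‖ ≤ B * ‖f c‖)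
    {z : ℂ} (hz : z ∈ Metric.closedBall c r) :
    ‖deriv f z / f z‖ ≤ 8 * R / (R - r) ^ 2 * Real.log B := by
  have hR : 0 < R := hr.trans_lt hrR
  have hcb : c ∈ Metric.ball c R := Metric.mem_ball_self hR
  have hlog : 0 < Real.log B := Real.log_pos hB
  obtain ⟨L, hL0, hL⟩ := ((hf.deriv Metric.isOpen_ball).div hf hf0).isExactOn_ball.with_val_at c 0
  have hLd : DifferentiableOn ℂ L (Metric.ball c R) :=
    fun w hw ↦ (hL w hw).differentiableAt.differentiableWithinAt
  have hexp : ∀ w ∈ Metric.ball c R, f w * Complex.exp (-L w) = f c := by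
    have hd : ∀ w ∈ Metric.ball c R,
        HasDerivAt (fun w ↦ f w * Complex.exp (-L w)) 0 w := by
      intro w hw
      have h1 := (hf.differentiableAt (Metric.isOpen_ball.mem_nhds hw)).hasDerivAt
      have h2 := h1.mul (hL w hw).neg.cexp
      refine HasDerivAt.congr_deriv h2 ?_
      have := hf0 w hw
      simp only [Pi.neg_apply, Pi.div_apply]
      field_simp
      ring
    intro w hw
    have := (convex_ball c R).is_const_of_fderivWithin_eq_zero (𝕜 := ℂ)
      (f := fun w ↦ f w * Complex.exp (-L w))
      (fun w hw ↦ (hd w hw).differentiableAt.differentiableWithinAt)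
      (fun w hw ↦ by
        rw [fderivWithin_of_isOpen Metric.isOpen_ball hw]
        ext; simp [(hd w hw).deriv]) hw hcb
    simpa [hL0] using this
  have hre : ∀ w ∈ Metric.ball c R, (L w).re ≤ Real.log B := by
    intro w hw
    have h1 := hexp w hw
    have hfc : 0 < ‖f c‖ := norm_pos_iff.2 (hf0 c hcb)
    have h2 : ‖f w‖ = ‖f c‖ * Real.exp (L w).re := by
      rw [← h1, norm_mul, Complex.norm_exp, mul_assoc, ← Real.exp_add]
      simp
    rw [Real.le_log_iff_exp_le (by linarith)]
    have := hfB w hw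
    rw [h2, mul_comm] at this
    exact le_of_mul_le_mul_right this hfc
  set d : ℝ := (R - r) / 2 with hd
  have hd0 : 0 < d := by rw [hd]; linarith
  have hbound : ∀ w ∈ Metric.sphere z d, ‖L w‖ ≤ 2 * Real.log B * R / d := by
    intro w hw
    have hwc : ‖w - c‖ ≤ R - d := by
      have h1 : dist w c ≤ dist w z + dist z c := dist_triangle _ _ _
      rw [Metric.mem_sphere] at hw
      rw [Metric.mem_closedBall] at hz
      rw [← dist_eq_norm]; rw [hd] at hw ⊢; linarith
    have := Complex.borelCaratheodory_zero (f := fun u ↦ L (u + c)) (M := Real.log B) (R := R)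
      (z := w - c) hlog
      (hLd.comp (by fun_prop) (fun u hu ↦ by simpa using hu))
      (fun u hu ↦ hre (u + c) (by simpa using hu)) hR
      (by simpa using (by linarith : ‖w - c‖ < R)) (by simpa using hL0)
    simp only [sub_add_cancel] at this
    refine this.trans ?_
    gcongr <;> linarith
  have hzR : z ∈ Metric.ball c R := Metric.closedBall_subset_ball hrR hz
  have hsub : Metric.closedBall z d ⊆ Metric.ball c R := by
    intro w hw
    rw [Metric.mem_closedBall] at hw hz
    have h1 : dist w c ≤ dist w z + dist z c := dist_triangle _ _ _
    rw [Metric.mem_ball]; rw [hd] at hw; linarith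
  have hder := Complex.norm_deriv_le_of_forall_mem_sphere_norm_le hd0
    (hLd.diffContOnCl_ball hsub) hbound
  rw [(hL z hzR).deriv] at hder
  refine hder.trans (le_of_eq ?_)
  have : R - r ≠ 0 := by linarith
  rw [hd]; field_simp; ring

/-- The function `- logDeriv ζ s - s / (s - 1)`, continued analytically to the point `s = 1`. -/
noncomputable def psiErrorTransform (s : ℂ) : ℂ :=
  -(deriv subOneMulZeta s / subOneMulZeta s) - 1

lemma psiErrorTransform_eq {s : ℂ} (hs : 1 < s.re) :
    psiErrorTransform s = -deriv riemannZeta s / riemannZeta s - s / (s - 1) := by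
  have h1 : s ≠ 1 := by rintro rfl; simp at hs
  have h1' : s - 1 ≠ 0 := sub_ne_zero.2 h1
  have hz : riemannZeta s ≠ 0 := riemannZeta_ne_zero_of_one_le_re hs.le
  have hd : deriv subOneMulZeta s = riemannZeta s + (s - 1) * deriv riemannZeta s := by
    rw [(subOneMulZeta_eventuallyEq h1).deriv_eq]
    have := ((hasDerivAt_id s).sub_const 1).mul (differentiableAt_riemannZeta h1).hasDerivAt
    refine Eq.trans this.deriv ?_
    simp
  rw [psiErrorTransform, hd, subOneMulZeta_of_ne h1]
  field_simp
  ring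

lemma differentiableOn_psiErrorTransform (hRH : RiemannHypothesis) :
    DifferentiableOn ℂ psiErrorTransform {s | 1 / 2 < s.re} := by
  have hU : IsOpen {s : ℂ | 1 / 2 < s.re} := isOpen_lt continuous_const Complex.continuous_re
  have hH := differentiable_subOneMulZeta.differentiableOn (s := {s : ℂ | 1 / 2 < s.re})
  exact ((hH.deriv hU).div hH fun s hs ↦ subOneMulZeta_ne_zero hRH hs).neg.sub_const 1

/-- Under the Riemann hypothesis, the logarithmic derivative of `ζ` grows more slowly than
any power on vertical strips to the right of the critical line. -/
lemma exists_norm_psiErrorTransform_le (hRH : RiemannHypothesis) {σ η : ℝ} (hσ : 1 / 2 < σ)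
    (hη : 0 < η) :
    ∃ C, 0 < C ∧ ∀ s : ℂ, σ ≤ s.re → s.re ≤ 2 →
      ‖psiErrorTransform s‖ ≤ C * (1 + s.im ^ 2) ^ η := by
  by_cases hσ2 : 2 < σ
  · exact ⟨1, one_pos, fun s h1 h2 ↦ by linarith⟩
  rw [not_lt] at hσ2
  set K : ℝ := 8 * (3 / 2) / (3 / 2 - (2 - σ)) ^ 2
  have hK : 0 ≤ K := by positivity
  refine ⟨K * (300 ^ η / η) + 1, by positivity, fun s h1 h2 ↦ ?_⟩
  set t := s.im
  have ht1 : 1 ≤ (1 + t ^ 2) ^ η := Real.one_le_rpow (by nlinarith) hη.le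
  set c : ℂ := 2 + t * Complex.I with hc
  have hcn : ‖c‖ ≤ 2 + |t| := by
    refine (norm_add_le _ _).trans (by simp)
  have hsc : s ∈ Metric.closedBall c (2 - σ) := by
    have : s - c = ((s.re - 2 : ℝ) : ℂ) := by
      apply Complex.ext <;> simp [hc, t]
    rw [Metric.mem_closedBall, dist_eq_norm, this, Complex.norm_real, Real.norm_eq_abs, abs_le]
    constructor <;> linarith
  have hball : ∀ z ∈ Metric.ball c (3 / 2), 1 / 2 < z.re := by
    intro z hz
    rw [Metric.mem_ball, dist_eq_norm] at hz
    have h3 := (abs_lt.1 ((Complex.abs_re_le_norm (z - c)).trans_lt hz)).1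
    simp [hc] at h3
    linarith
  have hB : ∀ z ∈ Metric.ball c (3 / 2),
      ‖subOneMulZeta z‖ ≤ 300 * (1 + t ^ 2) * ‖subOneMulZeta c‖ := by
    intro z hz
    have hz1 := norm_subOneMulZeta_le (hball z hz).le
    rw [Metric.mem_ball, dist_eq_norm] at hz
    have hzn : ‖z‖ ≤ 7 / 2 + |t| := by
      have := norm_add_le (z - c) c
      rw [sub_add_cancel] at this
      linarith
    have hz1n : ‖z - 1‖ ≤ 9 / 2 + |t| := by
      have := norm_sub_le z 1
      rw [norm_one] at this
      linarith
    have hlow := one_fifth_le_norm_subOneMulZeta t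
    have h4 : ‖z‖ * ‖z - 1‖ ≤ (7 / 2 + |t|) * (9 / 2 + |t|) := by gcongr
    have habs : |t| ^ 2 = t ^ 2 := sq_abs t
    have h5 : ‖subOneMulZeta z‖ ≤ 60 * (1 + t ^ 2) := by
      nlinarith [sq_nonneg (|t| - 1)]
    nlinarith [sq_nonneg t]
  have key := norm_logDeriv_le_of_ne_zero (f := subOneMulZeta) (c := c) (r := 2 - σ) (R := 3 / 2)
    (B := 300 * (1 + t ^ 2)) (by linarith) (by linarith)
    differentiable_subOneMulZeta.differentiableOn
    (fun z hz ↦ subOneMulZeta_ne_zero hRH (hball z hz)) (by nlinarith [sq_nonneg t]) hB hsc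
  have hlog : Real.log (300 * (1 + t ^ 2)) ≤ 300 ^ η / η * (1 + t ^ 2) ^ η := by
    have := Real.log_le_rpow_div (x := 300 * (1 + t ^ 2)) (by positivity) hη
    rw [Real.mul_rpow (by positivity) (by positivity)] at this
    exact this.trans (le_of_eq (by ring))
  calc ‖psiErrorTransform s‖ ≤ ‖deriv subOneMulZeta s / subOneMulZeta s‖ + 1 := by
        rw [psiErrorTransform]
        refine (norm_sub_le _ _).trans (by rw [norm_neg, norm_one])
    _ ≤ K * (300 ^ η / η * (1 + t ^ 2) ^ η) + (1 + t ^ 2) ^ η := by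
        gcongr
        exact key.trans (by gcongr)
    _ = _ := by ring

/-- The relative error `(ψ(u) - u) / u` in the prime number theorem. -/
noncomputable def psiRelError (u : ℝ) : ℝ := (Chebyshev.psi u - u) / u

lemma measurable_psiRelError : Measurable psiRelError :=
  (Chebyshev.psi_mono.measurable.sub measurable_id).div measurable_id

lemma exists_abs_psiRelError_le : ∃ C, 0 < C ∧ ∀ u, |psiRelError u| ≤ C := by
  have hlog : 0 < Real.log 4 := Real.log_pos (by norm_num)
  refine ⟨Real.log 4 + 5, by linarith, fun u ↦ ?_⟩
  rcases le_or_gt u 0 with hu | hu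
  · rcases hu.eq_or_lt with rfl | hu'
    · simp [psiRelError]; linarith
    · rw [psiRelError, Chebyshev.psi_eq_zero_of_le_one (by linarith), zero_sub, neg_div,
        div_self hu'.ne, abs_neg, abs_one]
      linarith
  · rw [psiRelError, abs_div, abs_of_pos hu, div_le_iff₀ hu, abs_le]
    have h1 := Chebyshev.psi_nonneg u
    have h2 := Chebyshev.psi_le_const_mul_self hu.le
    constructor <;> nlinarith

lemma intervalIntegrable_psiRelError (a b : ℝ) : IntervalIntegrable psiRelError volume a b := by
  obtain ⟨C, _, hC⟩ := exists_abs_psiRelError_le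
  refine (intervalIntegrable_const (c := C)).mono_fun
    measurable_psiRelError.aestronglyMeasurable (Eventually.of_forall fun u ↦ ?_)
  exact (hC u).trans (le_abs_self C)

/-- The integral of `(ψ(u) - u) / u` from `1` to `max x 1`. -/
noncomputable def psiErrorPrimitive (x : ℝ) : ℝ := ∫ u in 1..max x 1, psiRelError u

lemma continuous_psiErrorPrimitive : Continuous psiErrorPrimitive :=
  (intervalIntegral.continuous_primitive intervalIntegrable_psiRelError 1).comp (by fun_prop)

lemma psiErrorPrimitive_sub {x y : ℝ} (hx : 1 ≤ x) (hy : 1 ≤ y) :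
    psiErrorPrimitive y - psiErrorPrimitive x = ∫ u in x..y, psiRelError u := by
  rw [psiErrorPrimitive, psiErrorPrimitive, max_eq_left hx, max_eq_left hy]
  exact intervalIntegral.integral_interval_sub_left (intervalIntegrable_psiRelError _ _)
    (intervalIntegrable_psiRelError _ _)

lemma integral_psi_sub_mul_cpow {s : ℂ} (hs : 1 < s.re) :
    ∫ t in Ioi (1 : ℝ), (psiRelError t : ℂ) * (t : ℂ) ^ (-s) = psiErrorTransform s / s := by
  have hs0 : s ≠ 0 := by rintro rfl; simp at hs; linarith
  have hpsi (t : ℝ) : ∑ k ∈ Finset.Icc 1 ⌊t⌋₊, ArithmeticFunction.vonMangoldt k =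
      Chebyshev.psi t := rfl
  have h := LSeries_sub_div_eq_mul_integral (f := fun n ↦ ArithmeticFunction.vonMangoldt n)
    (fun n ↦ ArithmeticFunction.vonMangoldt_nonneg) (C := Real.log 4 + 4) (fun n ↦ by
      have := Chebyshev.psi_le_const_mul_self (Nat.cast_nonneg (α := ℝ) n)
      rwa [← hpsi, Nat.floor_natCast] at this) hs
  rw [ArithmeticFunction.LSeries_vonMangoldt_eq_deriv_riemannZeta_div hs,
    ← psiErrorTransform_eq hs] at h
  rw [h, mul_div_cancel_left₀ _ hs0]
  refine setIntegral_congr_fun measurableSet_Ioi fun t ht ↦ ?_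
  have ht0 : (t : ℂ) ≠ 0 := by exact_mod_cast (zero_lt_one.trans ht).ne'
  simp only [hpsi, psiRelError]
  rw [show -(s + 1) = -s - 1 by ring, Complex.cpow_sub _ _ ht0, Complex.cpow_one]
  push_cast
  ring

/-- The kernel whose two iterated integrals compute the Mellin transform of
`psiErrorPrimitive`. -/
lemma integrable_psiRelError_kernel {s : ℂ} (hs : 1 < s.re) :
    Integrable (fun p : ℝ × ℝ ↦ {q : ℝ × ℝ | q.2 ≤ q.1}.indicator
      (fun q ↦ (q.1 : ℂ) ^ (-s - 1) * (psiRelError q.2 : ℂ)) p)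
      ((volume.restrict (Ioi 1)).prod (volume.restrict (Ioi 1))) := by
  obtain ⟨C, hC0, hC⟩ := exists_abs_psiRelError_le
  set a : ℝ := (s.re + 1) / 2 with ha
  have ha1 : 1 < a := by rw [ha]; linarith
  have hI : IntegrableOn (fun t : ℝ ↦ t ^ (-a)) (Ioi 1) :=
    integrableOn_Ioi_rpow_of_lt (by linarith) one_pos
  refine ((hI.mul_prod hI).const_mul C).mono' ?_ ?_
  · refine Measurable.aestronglyMeasurable ?_
    refine Measurable.indicator ?_ (measurableSet_le measurable_snd measurable_fst)
    refine Measurable.mul ?_ ?_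
    · exact (Complex.measurable_ofReal.comp measurable_fst).pow_const _
    · exact Complex.measurable_ofReal.comp (measurable_psiRelError.comp measurable_snd)
  · rw [Measure.prod_restrict]
    refine (ae_restrict_iff' (measurableSet_Ioi.prod measurableSet_Ioi)).2
      (Eventually.of_forall fun p hp ↦ ?_)
    obtain ⟨h1, h2⟩ := hp
    have h1' : 0 < p.1 := zero_lt_one.trans h1
    have h2' : 0 < p.2 := zero_lt_one.trans h2
    by_cases hle : p.2 ≤ p.1
    · rw [indicator_of_mem (by exact hle), norm_mul, Complex.norm_cpow_eq_rpow_re_of_pos h1',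
        Complex.norm_real, Real.norm_eq_abs, mul_comm]
      have hexp : (-s - 1).re = -a + -a := by simp [ha]; ring
      rw [hexp, Real.rpow_add h1']
      have : p.1 ^ (-a) ≤ p.2 ^ (-a) :=
        Real.rpow_le_rpow_of_nonpos h2' hle (by linarith)
      gcongr
      exact hC _
    · rw [indicator_of_notMem (by exact hle), norm_zero]
      positivity

lemma integral_kernel_right (s : ℂ) {x : ℝ} (hx : 1 < x) :
    ∫ u in Ioi (1 : ℝ), {q : ℝ × ℝ | q.2 ≤ q.1}.indicator
      (fun q ↦ (q.1 : ℂ) ^ (-s - 1) * (psiRelError q.2 : ℂ)) (x, u) =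
      (x : ℂ) ^ (-s - 1) • (psiErrorPrimitive x : ℂ) := by
  have h : ∀ u, {q : ℝ × ℝ | q.2 ≤ q.1}.indicator
      (fun q ↦ (q.1 : ℂ) ^ (-s - 1) * (psiRelError q.2 : ℂ)) (x, u) =
      (Iic x).indicator (fun u ↦ (x : ℂ) ^ (-s - 1) * (psiRelError u : ℂ)) u := by
    intro u
    by_cases hu : u ≤ x <;> simp [indicator, hu]
  simp only [h]
  rw [setIntegral_indicator measurableSet_Iic, Ioi_inter_Iic, integral_const_mul, smul_eq_mul,
    psiErrorPrimitive, max_eq_left hx.le, intervalIntegral.integral_of_le hx.le]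
  congr 1
  exact integral_ofReal

lemma integral_kernel_left {s : ℂ} (hs : 1 < s.re) {u : ℝ} (hu : 1 < u) :
    ∫ x in Ioi (1 : ℝ), {q : ℝ × ℝ | q.2 ≤ q.1}.indicator
      (fun q ↦ (q.1 : ℂ) ^ (-s - 1) * (psiRelError q.2 : ℂ)) (x, u) =
      (psiRelError u : ℂ) * (u : ℂ) ^ (-s) / s := by
  have h : ∀ x, {q : ℝ × ℝ | q.2 ≤ q.1}.indicator
      (fun q ↦ (q.1 : ℂ) ^ (-s - 1) * (psiRelError q.2 : ℂ)) (x, u) =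
      (Ici u).indicator (fun x : ℝ ↦ (x : ℂ) ^ (-s - 1) * (psiRelError u : ℂ)) x := by
    intro x
    by_cases hx : u ≤ x <;> simp [indicator, hx]
  have hs0 : s ≠ 0 := by rintro rfl; simp at hs; linarith
  simp only [h]
  rw [setIntegral_indicator measurableSet_Ici,
    inter_eq_right.2 (Ici_subset_Ioi.2 hu), integral_Ici_eq_integral_Ioi,
    integral_mul_const,
    integral_Ioi_cpow_of_lt (by simp; linarith) (zero_lt_one.trans hu), sub_add_cancel]
  field_simp

lemma integrableOn_cpow_smul_psiErrorPrimitive {s : ℂ} (hs : 1 < s.re) :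
    IntegrableOn (fun x : ℝ ↦ (x : ℂ) ^ (-s - 1) • (psiErrorPrimitive x : ℂ)) (Ioi 1) := by
  refine (integrable_psiRelError_kernel hs).integral_prod_left.congr ?_
  exact (ae_restrict_iff' measurableSet_Ioi).2
    (Eventually.of_forall fun x hx ↦ integral_kernel_right s hx)

lemma cpow_smul_psiErrorPrimitive_eq_zero (s : ℂ) {x : ℝ} (hx : x ≤ 1) :
    (x : ℂ) ^ (-s - 1) • (psiErrorPrimitive x : ℂ) = 0 := by
  simp [psiErrorPrimitive, max_eq_right hx]

lemma hasMellin_psiErrorPrimitive {s : ℂ} (hs : 1 < s.re) :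
    HasMellin (fun x ↦ (psiErrorPrimitive x : ℂ)) (-s) (psiErrorTransform s / s ^ 2) := by
  constructor
  · refine IntegrableOn.of_forall_sdiff_eq_zero
      (integrableOn_cpow_smul_psiErrorPrimitive hs) measurableSet_Ioi fun x hx ↦ ?_
    exact cpow_smul_psiErrorPrimitive_eq_zero s (not_lt.1 hx.2)
  · have hsub : ∫ x in Ioi (0 : ℝ), (x : ℂ) ^ (-s - 1) • (psiErrorPrimitive x : ℂ) =
        ∫ x in Ioi (1 : ℝ), (x : ℂ) ^ (-s - 1) • (psiErrorPrimitive x : ℂ) := by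
      refine setIntegral_eq_of_subset_of_forall_sdiff_eq_zero measurableSet_Ioi
        (Ioi_subset_Ioi zero_le_one) fun x hx ↦ ?_
      exact cpow_smul_psiErrorPrimitive_eq_zero s (not_lt.1 hx.2)
    rw [mellin, hsub]
    calc ∫ x in Ioi (1 : ℝ), (x : ℂ) ^ (-s - 1) • (psiErrorPrimitive x : ℂ)
        = ∫ x in Ioi (1 : ℝ), ∫ u in Ioi (1 : ℝ), {q : ℝ × ℝ | q.2 ≤ q.1}.indicator
          (fun q ↦ (q.1 : ℂ) ^ (-s - 1) * (psiRelError q.2 : ℂ)) (x, u) :=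
          setIntegral_congr_fun measurableSet_Ioi fun x hx ↦ (integral_kernel_right s hx).symm
      _ = ∫ u in Ioi (1 : ℝ), ∫ x in Ioi (1 : ℝ), {q : ℝ × ℝ | q.2 ≤ q.1}.indicator
          (fun q ↦ (q.1 : ℂ) ^ (-s - 1) * (psiRelError q.2 : ℂ)) (x, u) :=
          integral_integral_swap (integrable_psiRelError_kernel hs)
      _ = ∫ u in Ioi (1 : ℝ), (psiRelError u : ℂ) * (u : ℂ) ^ (-s) / s :=
          setIntegral_congr_fun measurableSet_Ioi fun u hu ↦ integral_kernel_left hs hu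
      _ = psiErrorTransform s / s ^ 2 := by
          rw [integral_div, integral_psi_sub_mul_cpow hs, div_div, sq]

/-- Shifting a vertical line of integration inside a strip of holomorphy. -/
lemma integral_vertical_eq_of_norm_le {f : ℂ → ℂ} {g : ℝ → ℝ} {a b : ℝ} (hab : a ≤ b)
    (hf : DifferentiableOn ℂ f {s | a ≤ s.re ∧ s.re ≤ b}) (hg : Integrable g)
    (hfg : ∀ s : ℂ, a ≤ s.re → s.re ≤ b → ‖f s‖ ≤ g s.im)
    (hg_top : Tendsto g atTop (𝓝 0)) (hg_bot : Tendsto g atBot (𝓝 0)) :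
    ∫ y : ℝ, f (a + y * Complex.I) = ∫ y : ℝ, f (b + y * Complex.I) := by
  have hint : ∀ c ∈ Icc a b, Integrable fun y : ℝ ↦ f (c + y * Complex.I) := by
    intro c hc
    refine hg.mono' ?_ (Eventually.of_forall fun y ↦ ?_)
    · refine Continuous.aestronglyMeasurable ?_
      refine hf.continuousOn.comp_continuous (by fun_prop) fun y ↦ ?_
      simpa using hc
    · simpa using hfg (c + y * Complex.I) (by simpa using hc.1) (by simpa using hc.2)
  have hlim : ∀ c ∈ Icc a b, Tendsto (fun T : ℝ ↦ ∫ y in -T..T, f (c + y * Complex.I)) atTop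
      (𝓝 (∫ y : ℝ, f (c + y * Complex.I))) := fun c hc ↦
    intervalIntegral_tendsto_integral (hint c hc) tendsto_neg_atTop_atBot tendsto_id
  have hhor : ∀ T : ℝ, ‖∫ x in a..b, f (x + T * Complex.I)‖ ≤ g T * |b - a| := by
    intro T
    refine intervalIntegral.norm_integral_le_of_norm_le_const fun x hx ↦ ?_
    rw [uIoc_of_le hab] at hx
    simpa using hfg (x + T * Complex.I) (by simpa using hx.1.le) (by simpa using hx.2)
  have htop : Tendsto (fun T : ℝ ↦ ∫ x in a..b, f (x + T * Complex.I)) atTop (𝓝 0) :=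
    squeeze_zero_norm hhor (by simpa using hg_top.mul_const |b - a|)
  have hbot : Tendsto (fun T : ℝ ↦ ∫ x in a..b, f (x + (-T : ℝ) * Complex.I)) atTop (𝓝 0) :=
    squeeze_zero_norm (fun T ↦ hhor (-T))
      (by simpa using (hg_bot.comp tendsto_neg_atTop_atBot).mul_const |b - a|)
  have hrect : ∀ T : ℝ, (∫ x in a..b, f (x + (-T : ℝ) * Complex.I)) -
      (∫ x in a..b, f (x + T * Complex.I)) + Complex.I • (∫ y in -T..T, f (b + y * Complex.I)) -
      Complex.I • (∫ y in -T..T, f (a + y * Complex.I)) = 0 := by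
    intro T
    have := Complex.integral_boundary_rect_eq_zero_of_differentiableOn f
      (a + (-T : ℝ) * Complex.I) (b + T * Complex.I) (hf.mono fun s hs ↦ by
        have := hs.1
        simpa [uIcc_of_le hab] using this)
    simpa using this
  have hL := ((hbot.sub htop).add ((hlim b ⟨hab, le_rfl⟩).const_smul Complex.I)).sub
    ((hlim a ⟨le_rfl, hab⟩).const_smul Complex.I)
  simp only [hrect] at hL
  have h0 := tendsto_nhds_unique hL tendsto_const_nhds
  rw [sub_zero, zero_add, ← smul_sub, smul_eq_zero_iff_right Complex.I_ne_zero, sub_eq_zero] at h0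
  exact h0.symm

lemma integrable_one_add_sq_rpow {r : ℝ} (hr : r < -(1 / 2)) :
    Integrable fun t : ℝ ↦ (1 + t ^ 2) ^ r := by
  have := integrable_rpow_neg_one_add_norm_sq (E := ℝ) (μ := volume) (r := -2 * r)
    (by simp; linarith)
  simpa [show -(-2 * r) / 2 = r by ring] using this

lemma one_add_sq_div_four_le_normSq {s : ℂ} (hs : 1 / 2 ≤ s.re) :
    (1 + s.im ^ 2) / 4 ≤ ‖s‖ ^ 2 := by
  rw [Complex.sq_norm, Complex.normSq_apply]
  nlinarith [sq_nonneg s.im]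

/-- The integrand in the inversion formula for `psiErrorPrimitive`. -/
noncomputable def perronIntegrand (x : ℝ) (s : ℂ) : ℂ :=
  (x : ℂ) ^ s * (psiErrorTransform s / s ^ 2)

lemma differentiableOn_perronIntegrand (hRH : RiemannHypothesis) {x : ℝ} (hx : 0 < x) :
    DifferentiableOn ℂ (perronIntegrand x) {s | 1 / 2 < s.re} := by
  have hx0 : (x : ℂ) ≠ 0 := by exact_mod_cast hx.ne'
  refine DifferentiableOn.mul ?_ ((differentiableOn_psiErrorTransform hRH).div (by fun_prop) ?_)
  · exact fun s _ ↦ (differentiableAt_id.const_cpow (Or.inl hx0)).differentiableWithinAt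
  · rintro s hs
    refine pow_ne_zero 2 ?_
    rintro rfl
    simp at hs
    linarith

lemma exists_norm_perronIntegrand_le (hRH : RiemannHypothesis) {σ : ℝ} (hσ : 1 / 2 < σ) :
    ∃ C, 0 < C ∧ ∀ x : ℝ, 1 ≤ x → ∀ s : ℂ, σ ≤ s.re → s.re ≤ 2 →
      ‖perronIntegrand x s‖ ≤ C * x ^ (2 : ℝ) * (1 + s.im ^ 2) ^ (-(3 / 4) : ℝ) := by
  obtain ⟨C, hC0, hC⟩ := exists_norm_psiErrorTransform_le hRH hσ (η := 1 / 4) (by norm_num)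
  refine ⟨4 * C, by positivity, fun x hx s h1 h2 ↦ ?_⟩
  have hx0 : 0 < x := by linarith
  have hsq := one_add_sq_div_four_le_normSq (s := s) (by linarith)
  have hp : 0 < 1 + s.im ^ 2 := by positivity
  rw [perronIntegrand, norm_mul, norm_div, norm_pow, Complex.norm_cpow_eq_rpow_re_of_pos hx0]
  calc x ^ s.re * (‖psiErrorTransform s‖ / ‖s‖ ^ 2)
      ≤ x ^ (2 : ℝ) * (C * (1 + s.im ^ 2) ^ (1 / 4 : ℝ) / ((1 + s.im ^ 2) / 4)) := by
        gcongr
        exact hC s h1 h2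
    _ = _ := by
        rw [show (-(3 / 4) : ℝ) = 1 / 4 - 1 by norm_num, Real.rpow_sub hp, Real.rpow_one]
        field_simp

lemma integrable_perronIntegrand (hRH : RiemannHypothesis) {σ : ℝ} (hσ : 1 / 2 < σ) (hσ2 : σ ≤ 2)
    {x : ℝ} (hx : 1 ≤ x) : Integrable fun y : ℝ ↦ perronIntegrand x (σ + y * Complex.I) := by
  obtain ⟨C, hC0, hC⟩ := exists_norm_perronIntegrand_le hRH hσ
  refine ((integrable_one_add_sq_rpow (r := -(3 / 4)) (by norm_num)).const_mul
    (C * x ^ (2 : ℝ))).mono' ?_ (Eventually.of_forall fun y ↦ ?_)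
  · refine Continuous.aestronglyMeasurable ?_
    refine (differentiableOn_perronIntegrand hRH (by linarith)).continuousOn.comp_continuous
      (by fun_prop) fun y ↦ ?_
    simpa using hσ
  · simpa using hC x hx (σ + y * Complex.I) (by simp) (by simpa using hσ2)

/-- The inversion formula on the line `Re s = 2`. -/
lemma psiErrorPrimitive_eq_integral_two (hRH : RiemannHypothesis) {x : ℝ} (hx : 1 ≤ x) :
    (psiErrorPrimitive x : ℂ) =
      (1 / (2 * π)) • ∫ y : ℝ, perronIntegrand x ((2 : ℝ) + y * Complex.I) := by
  have hM (y : ℝ) : mellin (fun x ↦ (psiErrorPrimitive x : ℂ)) (((-2 : ℝ) : ℂ) + y * Complex.I) =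
      psiErrorTransform ((2 : ℝ) + (-y : ℝ) * Complex.I) /
        ((2 : ℝ) + (-y : ℝ) * Complex.I) ^ 2 := by
    have := (hasMellin_psiErrorPrimitive (s := (2 : ℝ) + (-y : ℝ) * Complex.I) (by simp)).2
    rw [← this]
    congr 1
    push_cast
    ring
  have hint := integrable_perronIntegrand hRH (σ := 2) (by norm_num) le_rfl (le_refl (1 : ℝ))
  have key := mellinInv_mellin_eq (-2) (fun x ↦ (psiErrorPrimitive x : ℂ)) (x := x) (by linarith)
    (by simpa using (hasMellin_psiErrorPrimitive (s := 2) (by simp)).1)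
    (by
      rw [Complex.VerticalIntegrable]
      simp only [hM]
      simpa [perronIntegrand] using hint.comp_neg)
    (Complex.continuous_ofReal.comp continuous_psiErrorPrimitive).continuousAt
  rw [← key, mellinInv]
  congr 1
  rw [← integral_neg_eq_self (fun y : ℝ ↦ perronIntegrand x ((2 : ℝ) + y * Complex.I))]
  congr 1
  ext y
  rw [hM, perronIntegrand, smul_eq_mul]
  congr 2
  push_cast
  ring

/-- The inversion formula on any line to the right of the critical line. -/
lemma psiErrorPrimitive_eq_integral (hRH : RiemannHypothesis) {σ : ℝ} (hσ : 1 / 2 < σ)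
    (hσ2 : σ ≤ 2) {x : ℝ} (hx : 1 ≤ x) :
    (psiErrorPrimitive x : ℂ) =
      (1 / (2 * π)) • ∫ y : ℝ, perronIntegrand x (σ + y * Complex.I) := by
  obtain ⟨C, hC0, hC⟩ := exists_norm_perronIntegrand_le hRH hσ
  have hsq : Tendsto (fun t : ℝ ↦ (1 + t ^ 2) ^ (-(3 / 4) : ℝ)) (cocompact ℝ) (𝓝 0) := by
    refine (tendsto_rpow_neg_atTop (y := 3 / 4) (by norm_num)).comp ?_
    refine tendsto_atTop_add_const_left _ _ ?_
    have := (tendsto_pow_atTop (α := ℝ) two_ne_zero).comp (tendsto_norm_cocompact_atTop (E := ℝ))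
    simpa [Function.comp_def] using this
  have hlim := hsq.const_mul (C * x ^ (2 : ℝ))
  rw [mul_zero] at hlim
  rw [psiErrorPrimitive_eq_integral_two hRH hx,
    integral_vertical_eq_of_norm_le (f := perronIntegrand x)
      (g := fun t ↦ C * x ^ (2 : ℝ) * (1 + t ^ 2) ^ (-(3 / 4) : ℝ)) hσ2 ?_ ?_ (hC x hx)
      (hlim.mono_left atTop_le_cocompact) (hlim.mono_left atBot_le_cocompact)]
  · exact (differentiableOn_perronIntegrand hRH (by linarith)).mono
      fun s hs ↦ hσ.trans_le hs.1
  · exact (integrable_one_add_sq_rpow (by norm_num)).const_mul _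

lemma norm_exp_sub_one_le_rpow {z : ℂ} (hz : z.re ≤ 1) {θ : ℝ} (hθ : 0 ≤ θ) (hθ1 : θ ≤ 1) :
    ‖Complex.exp z - 1‖ ≤ 4 * ‖z‖ ^ θ := by
  rcases le_or_gt ‖z‖ 1 with h | h
  · have h1 : ‖z‖ ≤ ‖z‖ ^ θ := by
      rcases (norm_nonneg z).eq_or_lt with h0 | h0
      · rw [← h0]; positivity
      · simpa using Real.rpow_le_rpow_of_exponent_ge h0 h hθ1
    linarith [Complex.norm_exp_sub_one_le h, norm_nonneg z]
  · have h1 : 1 ≤ ‖z‖ ^ θ := Real.one_le_rpow h.le hθ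
    have h2 : ‖Complex.exp z‖ ≤ 3 := by
      rw [Complex.norm_exp]
      linarith [Real.exp_le_exp.2 hz, Real.exp_one_lt_d9]
    calc ‖Complex.exp z - 1‖ ≤ ‖Complex.exp z‖ + ‖(1 : ℂ)‖ := norm_sub_le _ _
      _ ≤ 4 * ‖z‖ ^ θ := by rw [norm_one]; linarith

lemma perronIntegrand_mul_exp_sub {x : ℝ} (hx : 0 < x) (h : ℝ) (s : ℂ) :
    perronIntegrand (x * Real.exp h) s - perronIntegrand x s =
      (x : ℂ) ^ s * (Complex.exp (h * s) - 1) * (psiErrorTransform s / s ^ 2) := by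
  have : ((x * Real.exp h : ℝ) : ℂ) ^ s = (x : ℂ) ^ s * Complex.exp (h * s) := by
    rw [Complex.ofReal_mul, Complex.mul_cpow_ofReal_nonneg hx.le (Real.exp_pos h).le,
      Complex.cpow_def_of_ne_zero (x := ((Real.exp h : ℝ) : ℂ))
        (by exact_mod_cast (Real.exp_pos h).ne'), ← Complex.ofReal_log (Real.exp_pos h).le,
      Real.log_exp]
  rw [perronIntegrand, perronIntegrand, this]
  ring

lemma exists_norm_perronIntegrand_mul_exp_sub_le (hRH : RiemannHypothesis) {σ η : ℝ}
    (hσ : 1 / 2 < σ) (hσ2 : σ ≤ 2) (hη : 0 < η) (hη1 : η ≤ 1) :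
    ∃ K, 0 < K ∧ ∀ x h t : ℝ, 0 < x → 0 < h → h ≤ 1 / 2 →
      ‖perronIntegrand (x * Real.exp h) (σ + t * Complex.I) -
        perronIntegrand x (σ + t * Complex.I)‖ ≤
      K * x ^ σ * h ^ (1 - η) * (1 + t ^ 2) ^ (-(1 / 2) - η / 4) := by
  obtain ⟨C, hC0, hC⟩ := exists_norm_psiErrorTransform_le hRH hσ (η := η / 4) (by linarith)
  refine ⟨4 * C * 4 ^ ((1 + η) / 2), by positivity, fun x h t hx hh hh2 ↦ ?_⟩
  set s : ℂ := σ + t * Complex.I with hs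
  have hre : s.re = σ := by simp [hs]
  have him : s.im = t := by simp [hs]
  have hs0 : 0 < ‖s‖ := norm_pos_iff.2 fun h0 ↦ by rw [h0] at hre; simp at hre; linarith
  have hT : ‖psiErrorTransform s‖ ≤ C * (1 + t ^ 2) ^ (η / 4) := by
    simpa [him] using hC s hre.ge (hre.trans_le hσ2)
  have hE : ‖Complex.exp (h * s) - 1‖ ≤ 4 * (h ^ (1 - η) * ‖s‖ ^ (1 - η)) := by
    have := norm_exp_sub_one_le_rpow (z := h * s) (by
      rw [Complex.re_ofReal_mul, hre]; nlinarith) (θ := 1 - η) (by linarith) (by linarith)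
    rwa [norm_mul, Complex.norm_of_nonneg hh.le, Real.mul_rpow hh.le hs0.le] at this
  have hS : ‖s‖ ^ (1 - η) / ‖s‖ ^ 2 ≤ 4 ^ ((1 + η) / 2) * (1 + t ^ 2) ^ (-((1 + η) / 2)) := by
    have h4 := one_add_sq_div_four_le_normSq (s := s) (by linarith)
    rw [him] at h4
    calc ‖s‖ ^ (1 - η) / ‖s‖ ^ 2 = (‖s‖ ^ 2) ^ (-((1 + η) / 2)) := by
          rw [← Real.rpow_natCast, ← Real.rpow_sub hs0, ← Real.rpow_mul hs0.le]
          congr 1; push_cast; ring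
      _ ≤ ((1 + t ^ 2) / 4) ^ (-((1 + η) / 2)) :=
          Real.rpow_le_rpow_of_nonpos (by positivity) h4 (by linarith)
      _ = 4 ^ ((1 + η) / 2) * (1 + t ^ 2) ^ (-((1 + η) / 2)) := by
          rw [Real.div_rpow (by positivity) (by norm_num), Real.rpow_neg (x := 4) (by norm_num)]
          field_simp
  rw [perronIntegrand_mul_exp_sub hx, norm_mul, norm_mul, norm_div, norm_pow,
    Complex.norm_cpow_eq_rpow_re_of_pos hx, hre]
  calc x ^ σ * ‖Complex.exp (h * s) - 1‖ * (‖psiErrorTransform s‖ / ‖s‖ ^ 2)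
      ≤ x ^ σ * (4 * (h ^ (1 - η) * ‖s‖ ^ (1 - η))) *
          (C * (1 + t ^ 2) ^ (η / 4) / ‖s‖ ^ 2) := by gcongr
    _ = 4 * C * x ^ σ * h ^ (1 - η) * (1 + t ^ 2) ^ (η / 4) *
          (‖s‖ ^ (1 - η) / ‖s‖ ^ 2) := by ring
    _ ≤ 4 * C * x ^ σ * h ^ (1 - η) * (1 + t ^ 2) ^ (η / 4) *
          (4 ^ ((1 + η) / 2) * (1 + t ^ 2) ^ (-((1 + η) / 2))) := by gcongr
    _ = 4 * C * 4 ^ ((1 + η) / 2) * x ^ σ * h ^ (1 - η) *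
          ((1 + t ^ 2) ^ (η / 4) * (1 + t ^ 2) ^ (-((1 + η) / 2))) := by ring
    _ = _ := by
          rw [← Real.rpow_add (by positivity)]
          congr 2; ring

lemma exists_abs_psiErrorPrimitive_mul_exp_sub_le (hRH : RiemannHypothesis) {σ η : ℝ}
    (hσ : 1 / 2 < σ) (hσ2 : σ ≤ 2) (hη : 0 < η) (hη1 : η ≤ 1) :
    ∃ K, 0 ≤ K ∧ ∀ x h : ℝ, 1 ≤ x → 0 < h → h ≤ 1 / 2 →
      |psiErrorPrimitive (x * Real.exp h) - psiErrorPrimitive x| ≤ K * x ^ σ * h ^ (1 - η) := by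
  obtain ⟨K, hK0, hK⟩ := exists_norm_perronIntegrand_mul_exp_sub_le hRH hσ hσ2 hη hη1
  have hint := integrable_one_add_sq_rpow (r := -(1 / 2) - η / 4) (by linarith)
  have hI : 0 ≤ ∫ t : ℝ, (1 + t ^ 2) ^ (-(1 / 2) - η / 4) :=
    integral_nonneg fun t ↦ by positivity
  refine ⟨1 / (2 * π) * (K * ∫ t : ℝ, (1 + t ^ 2) ^ (-(1 / 2) - η / 4)), by positivity,
    fun x h hx hh hh2 ↦ ?_⟩
  have hx' : 1 ≤ x * Real.exp h := by nlinarith [Real.add_one_le_exp h]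
  have hsub : ((psiErrorPrimitive (x * Real.exp h) - psiErrorPrimitive x : ℝ) : ℂ) =
      (1 / (2 * π)) • ∫ t : ℝ, (perronIntegrand (x * Real.exp h) (σ + t * Complex.I) -
        perronIntegrand x (σ + t * Complex.I)) := by
    rw [integral_sub (integrable_perronIntegrand hRH hσ hσ2 hx')
      (integrable_perronIntegrand hRH hσ hσ2 hx), smul_sub,
      ← psiErrorPrimitive_eq_integral hRH hσ hσ2 hx',
      ← psiErrorPrimitive_eq_integral hRH hσ hσ2 hx, Complex.ofReal_sub]
  have hnorm := norm_integral_le_of_norm_le (hint.const_mul (K * x ^ σ * h ^ (1 - η)))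
    (Eventually.of_forall fun t ↦ hK x h t (by linarith) hh hh2)
  rw [integral_const_mul] at hnorm
  rw [← Real.norm_eq_abs, ← Complex.norm_real, hsub, norm_smul,
    Real.norm_of_nonneg (by positivity)]
  calc _ ≤ 1 / (2 * π) * _ := mul_le_mul_of_nonneg_left hnorm (by positivity)
    _ = _ := by ring

lemma integral_const_div_sub_one (c : ℝ) {x h : ℝ} (hx : 0 < x) :
    ∫ u in x..x * Real.exp h, (c / u - 1) = c * h - x * (Real.exp h - 1) := by
  have hxh : 0 < x * Real.exp h := by positivity
  have h0 : (0 : ℝ) ∉ uIcc x (x * Real.exp h) := fun hm ↦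
    ((lt_min hx hxh).trans_le hm.1).false
  simp_rw [div_eq_mul_inv]
  rw [intervalIntegral.integral_sub
    ((intervalIntegral.intervalIntegrable_inv (fun u hu h ↦ h0 (h ▸ hu))
      continuousOn_id).const_mul c) intervalIntegrable_const,
    intervalIntegral.integral_const_mul, integral_inv h0, mul_div_cancel_left₀ _ hx.ne',
    Real.log_exp]
  simp
  ring

lemma intervalIntegrable_const_div_sub_one (c : ℝ) {x h : ℝ} (hx : 0 < x) :
    IntervalIntegrable (fun u ↦ c / u - 1) volume x (x * Real.exp h) := by
  have hxh : 0 < x * Real.exp h := by positivity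
  refine ContinuousOn.intervalIntegrable fun u hu ↦ ?_
  have : u ≠ 0 := ((lt_min hx hxh).trans_le hu.1).ne'
  exact ContinuousAt.continuousWithinAt (by fun_prop (disch := assumption))

lemma psi_mul_sub_le_psiErrorPrimitive_sub {x h : ℝ} (hx : 1 ≤ x) (hh : 0 ≤ h) :
    Chebyshev.psi x * h - x * (Real.exp h - 1) ≤
      psiErrorPrimitive (x * Real.exp h) - psiErrorPrimitive x := by
  have hxh : x ≤ x * Real.exp h := by nlinarith [Real.add_one_le_exp h]
  rw [psiErrorPrimitive_sub hx (hx.trans hxh), ← integral_const_div_sub_one _ (by linarith)]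
  refine intervalIntegral.integral_mono_on hxh
    (intervalIntegrable_const_div_sub_one _ (by linarith))
    (intervalIntegrable_psiRelError _ _) fun u hu ↦ ?_
  have hu0 : 0 < u := by linarith [hu.1]
  rw [psiRelError, sub_div, div_self hu0.ne']
  gcongr
  exact hu.1

lemma psiErrorPrimitive_sub_le_psi_mul_sub {x h : ℝ} (hx : 1 ≤ x) (hh : 0 ≤ h) :
    psiErrorPrimitive (x * Real.exp h) - psiErrorPrimitive x ≤
      Chebyshev.psi (x * Real.exp h) * h - x * (Real.exp h - 1) := by
  have hxh : x ≤ x * Real.exp h := by nlinarith [Real.add_one_le_exp h]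
  rw [psiErrorPrimitive_sub hx (hx.trans hxh), ← integral_const_div_sub_one _ (by linarith)]
  refine intervalIntegral.integral_mono_on hxh (intervalIntegrable_psiRelError _ _)
    (intervalIntegrable_const_div_sub_one _ (by linarith)) fun u hu ↦ ?_
  have hu0 : 0 < u := by linarith [hu.1]
  rw [psiRelError, sub_div, div_self hu0.ne']
  gcongr
  exact hu.2

lemma exists_abs_psi_sub_le (hRH : RiemannHypothesis) {σ η : ℝ}
    (hσ : 1 / 2 < σ) (hσ2 : σ ≤ 2) (hη : 0 < η) (hη1 : η ≤ 1) :
    ∃ K, 0 ≤ K ∧ ∀ x : ℝ, 4 ≤ x →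
      |Chebyshev.psi x - x| ≤ K * x ^ (σ + η / 2) + x ^ (1 / 2 : ℝ) := by
  obtain ⟨K, hK0, hK⟩ := exists_abs_psiErrorPrimitive_mul_exp_sub_le hRH hσ hσ2 hη hη1
  refine ⟨K, hK0, fun x hx ↦ ?_⟩
  have hx0 : 0 < x := by linarith
  set h : ℝ := x ^ (-(1 / 2) : ℝ) with hh
  have hpos : 0 < h := by positivity
  have hle : h ≤ 1 / 2 := by
    calc h ≤ 4 ^ (-(1 / 2) : ℝ) :=
          Real.rpow_le_rpow_of_nonpos (by norm_num) hx (by norm_num)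
      _ = 1 / 2 := by
          rw [show (4 : ℝ) = 2 ^ (2 : ℝ) by norm_num, ← Real.rpow_mul (by norm_num)]
          norm_num [Real.rpow_neg_one]
  have hxh : x * h = x ^ (1 / 2 : ℝ) := by
    nth_rewrite 1 [hh, ← Real.rpow_one x]
    rw [← Real.rpow_add hx0]; norm_num
  have hpow : x ^ σ * h ^ (1 - η) = x ^ (σ + η / 2) * h := by
    rw [hh, ← Real.rpow_mul hx0.le, ← Real.rpow_add hx0, ← Real.rpow_add hx0]
    congr 1; ring
  have hexp := abs_le.1 (Real.abs_exp_sub_one_sub_id_le (x := h)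
    (by rw [abs_of_pos hpos]; linarith))
  have hexp' := abs_le.1 (Real.abs_exp_sub_one_sub_id_le (x := -h)
    (by rw [abs_neg, abs_of_pos hpos]; linarith))
  rw [← hxh]
  refine abs_le.2 ⟨?_, ?_⟩ <;> refine le_of_mul_le_mul_right ?_ hpos
  · set y := x * Real.exp (-h) with hy
    have hyx : y * Real.exp h = x := by
      rw [hy, mul_assoc, ← Real.exp_add]; simp
    have hy1 : 1 ≤ y := by
      have : 1 / 4 ≤ Real.exp (-h) := by nlinarith
      nlinarith
    have hyx' : y ≤ x := by
      have : Real.exp (-h) ≤ 1 := by simpa using hpos.le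
      nlinarith
    have h1 := psiErrorPrimitive_sub_le_psi_mul_sub hy1 hpos.le
    have h2 := (abs_le.1 (hK y h hy1 hpos hle)).1
    have h3 : K * y ^ σ * h ^ (1 - η) ≤ K * x ^ σ * h ^ (1 - η) := by gcongr
    rw [hyx] at h1 h2
    rw [mul_sub, hyx, mul_one] at h1
    rw [mul_assoc, mul_assoc, hpow] at h3
    nlinarith
  · have h1 := psi_mul_sub_le_psiErrorPrimitive_sub (x := x) (by linarith) hpos.le
    have h2 := (abs_le.1 (hK x h (by linarith) hpos hle)).2
    rw [mul_assoc, hpow] at h2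
    nlinarith

lemma chebTheta_eq_theta (x : ℝ) : chebTheta x = Chebyshev.theta x := by
  rw [chebTheta, Chebyshev.theta_eq_sum_Icc, ← Nat.range_succ_eq_Icc_zero]

lemma exists_abs_theta_sub_le (hRH : RiemannHypothesis) {α : ℝ} (hα : 1 / 2 < α)
    (hα2 : α ≤ 2) : ∃ C, ∀ x : ℝ, 4 ≤ x → |Chebyshev.theta x - x| ≤ C * x ^ α := by
  obtain ⟨K, hK0, hK⟩ := exists_abs_psi_sub_le hRH (σ := 1 / 2 + (α - 1 / 2) / 2)
    (η := (α - 1 / 2) / 2) (by linarith) (by linarith) (by linarith) (by linarith)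
  obtain ⟨C, hC⟩ := Chebyshev.psi_sub_theta_le_mul_sqrt
  refine ⟨K + 1 + |C|, fun x hx ↦ ?_⟩
  have h1 : x ^ (1 / 2 + (α - 1 / 2) / 2 + (α - 1 / 2) / 2 / 2) ≤ x ^ α :=
    Real.rpow_le_rpow_of_exponent_le (by linarith) (by linarith)
  have h2 : x ^ (1 / 2 : ℝ) ≤ x ^ α := Real.rpow_le_rpow_of_exponent_le (by linarith) hα.le
  have h3 : |Chebyshev.psi x - Chebyshev.theta x| ≤ |C| * x ^ α := by
    rw [abs_of_nonneg (sub_nonneg.2 (Chebyshev.theta_le_psi x))]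
    refine (hC x).trans ?_
    rw [Real.sqrt_eq_rpow]
    gcongr
    exact le_abs_self C
  calc |Chebyshev.theta x - x|
      = |(Chebyshev.psi x - x) - (Chebyshev.psi x - Chebyshev.theta x)| := by ring_nf
    _ ≤ |Chebyshev.psi x - x| + |Chebyshev.psi x - Chebyshev.theta x| := abs_sub _ _
    _ ≤ (K * x ^ α + x ^ α) + |C| * x ^ α :=
        add_le_add ((hK x hx).trans (by gcongr)) h3
    _ = _ := by ring

end

/-- Under RH, for every ε > 0 eventually |θ(x) − x| ≤ x^(1/2+ε). -/
theorem stmt_4 (hRH : RiemannHypothesis) :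
    ∀ ε : ℝ, 0 < ε → ∃ X : ℝ, ∀ x : ℝ, X < x →
      |chebTheta x - x| ≤ x ^ ((1 : ℝ) / 2 + ε) := by
  intro ε hε
  have hε' : 0 < min ε 1 := lt_min hε one_pos
  obtain ⟨C, hC⟩ := exists_abs_theta_sub_le hRH (α := 1 / 2 + min ε 1 / 2) (by linarith)
    (by linarith [min_le_right ε 1])
  obtain ⟨X, hX⟩ := eventually_atTop.1
    ((tendsto_rpow_atTop (half_pos hε')).eventually_ge_atTop C)
  refine ⟨max X 4, fun x hx ↦ ?_⟩
  have hx4 : 4 ≤ x := (le_max_right _ _).trans hx.le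
  have hx0 : 0 < x := by linarith
  rw [chebTheta_eq_theta]
  calc |Chebyshev.theta x - x| ≤ C * x ^ (1 / 2 + min ε 1 / 2) := hC x hx4
    _ ≤ x ^ (min ε 1 / 2) * x ^ (1 / 2 + min ε 1 / 2) := by
        gcongr
        exact hX x ((le_max_left _ _).trans hx.le)
    _ = x ^ (1 / 2 + min ε 1) := by
        rw [← Real.rpow_add hx0]; congr 1; ring
    _ ≤ x ^ ((1 : ℝ) / 2 + ε) :=
        Real.rpow_le_rpow_of_exponent_le (by linarith) (by linarith [min_le_left ε 1])
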